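/- (3/(2π⁴)) · ∫₀^{2π} ∫_{θ₁}^{2π} ∫_{θ₂}^{2π} ∫_{θ₃}^{2π} [2 sin((θ₂ − θ₁)/2)]·[2 sin((θ₃ − θ₂)/2)] dθ₄ dθ₃ dθ₂ dθ₁ = 48/π² − 384/π⁴. (That is, the expected product E(s₂s₃) of the adjacent sides s₂ and s₃ of a uniform cyclic quadrilateral equals 48/π² − 384/π⁴.) -/

import Mathlib

open Real intervalIntegral

theorem hasDerivAt_half_sub_const (a x : ℝ) : HasDerivAt (fun x => (x - a) / 2) (1 / 2) x :=
  ((hasDerivAt_id x).sub_const a).div_const 2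

theorem hasDerivAt_half_const_sub (c x : ℝ) : HasDerivAt (fun x => (c - x) / 2) (-1 / 2) x :=
  ((hasDerivAt_id x).const_sub c).div_const 2

theorem integral_const_sub_mul_sin_half (a c : ℝ) :
    ∫ x in a..c, (c - x) * sin ((x - a) / 2) = 2 * (c - a) - 4 * sin ((c - a) / 2) := by
  have h : ∀ x ∈ Set.uIcc a c, HasDerivAt
      (fun x => (c - x) * (-2 * cos ((x - a) / 2)) - 4 * sin ((x - a) / 2))
      ((c - x) * sin ((x - a) / 2)) x := by
    intro x _
    refine HasDerivAt.congr_deriv ((((hasDerivAt_id x).const_sub c).mul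
      ((hasDerivAt_half_sub_const a x).cos.const_mul (-2))).sub
      ((hasDerivAt_half_sub_const a x).sin.const_mul 4)) ?_
    simp only [id]
    ring
  rw [integral_eq_sub_of_hasDerivAt h (Continuous.intervalIntegrable (by fun_prop) _ _)]
  simp only [sub_self, zero_div, sin_zero, cos_zero]
  ring

theorem integral_sin_half_mul_sin_half (a c : ℝ) :
    ∫ x in a..c, sin ((x - a) / 2) * sin ((c - x) / 2) =
      sin ((c - a) / 2) - (c - a) / 2 * cos ((c - a) / 2) := by
  have h : ∀ x ∈ Set.uIcc a c, HasDerivAt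
      (fun x => (sin (x - (a + c) / 2) - x * cos ((c - a) / 2)) / 2)
      (sin ((x - a) / 2) * sin ((c - x) / 2)) x := by
    intro x _
    refine HasDerivAt.congr_deriv (((((hasDerivAt_id x).sub_const ((a + c) / 2)).sin).sub
      ((hasDerivAt_id x).mul_const (cos ((c - a) / 2)))).div_const 2) ?_
    simp only [id]
    rw [show x - (a + c) / 2 = (x - a) / 2 - (c - x) / 2 by ring,
      show (c - a) / 2 = (x - a) / 2 + (c - x) / 2 by ring, cos_sub, cos_add]
    ring
  rw [integral_eq_sub_of_hasDerivAt h (Continuous.intervalIntegrable (by fun_prop) _ _),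
    show c - (a + c) / 2 = (c - a) / 2 by ring, show a - (a + c) / 2 = -((c - a) / 2) by ring,
    sin_neg]
  ring

theorem integral_side_mul_side_last (a b c : ℝ) :
    ∫ x in b..c, ∫ _y in x..c, (2 * sin ((b - a) / 2)) * (2 * sin ((x - b) / 2)) =
      8 * ((c - b) * sin ((b - a) / 2)) - 16 * (sin ((b - a) / 2) * sin ((c - b) / 2)) := by
  calc
    _ = ∫ x in b..c, 4 * sin ((b - a) / 2) * ((c - x) * sin ((x - b) / 2)) := by
      congr 1
      ext x
      rw [integral_const, smul_eq_mul]
      ring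
    _ = _ := by
      rw [integral_const_mul, integral_const_sub_mul_sin_half]
      ring

theorem integral_side_mul_side (a c : ℝ) :
    ∫ b in a..c, ∫ x in b..c, ∫ _y in x..c,
        (2 * sin ((b - a) / 2)) * (2 * sin ((x - b) / 2)) =
      16 * (c - a) - 48 * sin ((c - a) / 2) + 8 * ((c - a) * cos ((c - a) / 2)) := by
  simp only [integral_side_mul_side_last]
  rw [integral_sub (Continuous.intervalIntegrable (by fun_prop) _ _)
    (Continuous.intervalIntegrable (by fun_prop) _ _), integral_const_mul, integral_const_mul,
    integral_const_sub_mul_sin_half, integral_sin_half_mul_sin_half]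
  ring

theorem integral_sub_sin_half_add_mul_cos_half (a c : ℝ) :
    ∫ x in a..c, (16 * (c - x) - 48 * sin ((c - x) / 2) + 8 * ((c - x) * cos ((c - x) / 2))) =
      8 * (c - a) ^ 2 + 128 * cos ((c - a) / 2) + 16 * ((c - a) * sin ((c - a) / 2)) - 128 := by
  have h : ∀ x ∈ Set.uIcc a c, HasDerivAt
      (fun x => -8 * (c - x) ^ 2 - 128 * cos ((c - x) / 2) -
        16 * ((c - x) * sin ((c - x) / 2)))
      (16 * (c - x) - 48 * sin ((c - x) / 2) + 8 * ((c - x) * cos ((c - x) / 2))) x := by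
    intro x _
    have hx := (hasDerivAt_id x).const_sub c
    refine HasDerivAt.congr_deriv ((((hx.pow 2).const_mul (-8)).sub
      ((hasDerivAt_half_const_sub c x).cos.const_mul 128)).sub
      ((hx.mul (hasDerivAt_half_const_sub c x).sin).const_mul 16)) ?_
    simp only [id]
    norm_num
    ring
  rw [integral_eq_sub_of_hasDerivAt h (Continuous.intervalIntegrable (by fun_prop) _ _)]
  simp only [sub_self, zero_div, sin_zero, cos_zero]
  ring

theorem expected_product_s2_s3 :
    (3 / (2 * π ^ 4)) *
      ∫ θ₁ in (0:ℝ)..(2 * π), ∫ θ₂ in θ₁..(2 * π), ∫ θ₃ in θ₂..(2 * π), ∫ _θ₄ in θ₃..(2 * π),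
        (2 * Real.sin ((θ₂ - θ₁) / 2)) * (2 * Real.sin ((θ₃ - θ₂) / 2)) =
    48 / π ^ 2 - 384 / π ^ 4 := by
  simp only [integral_side_mul_side]
  rw [integral_sub_sin_half_add_mul_cos_half, show (2 * π - 0) / 2 = π by ring, cos_pi, sin_pi]
  field_simp
  ring
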